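/- arXiv:math/0309192 — 2 statements merged into one kernel-verified Lean document; each statement's English description precedes it below -/
import Mathlib

section
/- Let X be a labeled graph. The BKN-equation over X has a compatible solution if and only if one of the following conditions holds: (1) all charges k_v are nonzero and have one and the same sign, and the operator A⁺ is positive semidefinite and singular; (2) A⁺ has a negative real eigenvalue. -/
open Finset Matrix

/-- A labeled graph `X = (Γ, |B|, K)`: a finite connected graph with oriented edge set `W`
(carrying the fixed-point-free orientation-reversal involution `rev` and initial-vertex map
`ini`), positive integer weights `b` on oriented edges with `b (rev w) = b w`, and real
charges `k` on vertices. -/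
structure LabeledGraph (V W : Type) [Fintype V] [DecidableEq V] [Fintype W] [DecidableEq W] where
  rev : W → W
  rev_invol : ∀ w, rev (rev w) = w
  rev_ne : ∀ w, rev w ≠ w
  ini : W → V
  b : W → ℕ
  b_pos : ∀ w, 0 < b w
  b_symm : ∀ w, b (rev w) = b w
  k : V → ℝ
  edges_nonempty : Nonempty W
  connected : ∀ u v : V,
    Relation.ReflTransGen (fun x y => ∃ w, ini w = x ∧ ini (rev w) = y) u v

namespace LabeledGraph

variable {V W : Type} [Fintype V] [DecidableEq V] [Fintype W] [DecidableEq W]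

/-- The terminal vertex `w⁺ = (-w)⁻` of an oriented edge. -/
def ter (X : LabeledGraph V W) (w : W) : V := X.ini (X.rev w)

/-- The BKN-equation over `X`: `k_v · a_v = Σ_{w ∈ ∂v} (γ_w/|b_w|) · a_{w⁺}` for all `v`. -/
def BKN (X : LabeledGraph V W) (a : V → ℝ) (γ : W → ℝ) : Prop :=
  ∀ v : V, X.k v * a v =
    ∑ w ∈ univ.filter (fun w => X.ini w = v), γ w / (X.b w : ℝ) * a (X.ter w)

/-- Compatibility of a solution `(a,γ)`. -/
def Compatible (X : LabeledGraph V W) (a : V → ℝ) (γ : W → ℝ) : Prop :=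
  (∀ v, 0 ≤ a v) ∧ a ≠ 0 ∧ (∀ w, |γ w| ≤ 1) ∧
    (∀ w, |γ w * γ (X.rev w)| = 1 → γ (X.rev w) = γ w) ∧
    (∀ v, a v = 0 → ∀ w, X.ini w = v → γ w = 0 ∧ γ (X.rev w) = 0)

/-- The angle function is symmetric: `γ_{-w} = γ_w`. -/
def SymSol (X : LabeledGraph V W) (γ : W → ℝ) : Prop := ∀ w, γ (X.rev w) = γ w

/-- An NPC-solution: a compatible symmetric solution with positive length function and
`|γ| < 1`. -/
def NPCSolution (X : LabeledGraph V W) (a : V → ℝ) (γ : W → ℝ) : Prop :=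
  X.BKN a γ ∧ X.Compatible a γ ∧ X.SymSol γ ∧ (∀ v, 0 < a v) ∧ ∀ w, |γ w| < 1

/-- The operator `A⁺ = D⁺ − J` on `ℝ^V`. -/
noncomputable def Aplus (X : LabeledGraph V W) : Matrix V V ℝ :=
  Matrix.of fun v v' =>
    (if v = v' then |X.k v| else 0)
      - ∑ w ∈ univ.filter (fun w => X.ini w = v ∧ X.ter w = v'), (1 : ℝ) / (X.b w)

/-- The operator `A_λ = D − J_λ` on `ℝ^V` for a (symmetric `±1`-valued) function `λ` on `W`. -/
noncomputable def Aop (X : LabeledGraph V W) (lam : W → ℝ) : Matrix V V ℝ :=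
  Matrix.of fun v v' =>
    (if v = v' then X.k v else 0)
      - ∑ w ∈ univ.filter (fun w => X.ini w = v ∧ X.ter w = v'), lam w / (X.b w : ℝ)

/-- Two vertices lie in the same sign component. -/
def SameSign (X : LabeledGraph V W) : V → V → Prop :=
  Relation.ReflTransGen fun x y =>
    (∃ w, X.ini w = x ∧ X.ter w = y) ∧ 0 < X.k x * X.k y

/-- A `±1`-valued sign function `s` of type (ii): constant on sign components, alternating
along edges joining distinct sign components, and equal to `1` at some vertex of positive
charge. -/
def TypeII (X : LabeledGraph V W) (s : V → ℝ) : Prop :=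
  (∀ v, s v = 1 ∨ s v = -1) ∧
    (∀ u v, X.SameSign u v → s u = s v) ∧
    (∀ w, ¬ X.SameSign (X.ini w) (X.ter w) → s (X.ini w) = - s (X.ter w)) ∧
    (∃ v, s v = 1 ∧ 0 < X.k v)

/-- An admissible sign function: of type (ii), or identically zero when no type (ii)
function exists. -/
def Admissible (X : LabeledGraph V W) (s : V → ℝ) : Prop :=
  X.TypeII s ∨ (s = 0 ∧ ¬ ∃ s', X.TypeII s')

open scoped Classical in
/-- The operator `H = D_s − J₀` associated with an admissible sign function `s`; only
oriented edges with both endpoints in one and the same sign component contribute. -/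
noncomputable def Hop (X : LabeledGraph V W) (s : V → ℝ) : Matrix V V ℝ :=
  Matrix.of fun v v' =>
    (if v = v' then s v * X.k v else 0)
      - ∑ w ∈ univ.filter
          (fun w => X.ini w = v ∧ X.ter w = v' ∧ X.SameSign (X.ini w) (X.ter w)),
          (1 : ℝ) / (X.b w)

/-- `A` has a nonpositive real eigenvalue. -/
def HasNonposEigenvalue (A : Matrix V V ℝ) : Prop :=
  ∃ μ : ℝ, μ ≤ 0 ∧ ∃ x : V → ℝ, x ≠ 0 ∧ A.mulVec x = μ • x

/-- `A` has a negative real eigenvalue. -/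
def HasNegEigenvalue (A : Matrix V V ℝ) : Prop :=
  ∃ μ : ℝ, μ < 0 ∧ ∃ x : V → ℝ, x ≠ 0 ∧ A.mulVec x = μ • x

/-- `A` is positive semidefinite: `(Ax,x) ≥ 0` for all `x`. -/
def PosSemidef' (A : Matrix V V ℝ) : Prop := ∀ x : V → ℝ, 0 ≤ x ⬝ᵥ A.mulVec x

/-- `A` is singular: it has a nontrivial kernel. -/
def Singular (A : Matrix V V ℝ) : Prop := ∃ x : V → ℝ, x ≠ 0 ∧ A.mulVec x = 0

/-- `A` is supersingular: its kernel contains a vector with all coordinates nonzero. -/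
def Supersingular (A : Matrix V V ℝ) : Prop :=
  ∃ x : V → ℝ, (∀ v, x v ≠ 0) ∧ A.mulVec x = 0

/-- `A` is weakly singular: there is a nonzero `x` with `(Ax)_v = 0` at every vertex of the
support of `x`. -/
def WeaklySingular (A : Matrix V V ℝ) : Prop :=
  ∃ x : V → ℝ, x ≠ 0 ∧ ∀ v, x v ≠ 0 → A.mulVec x v = 0

end LabeledGraph

namespace LabeledGraph

variable {V W : Type} [Fintype V] [DecidableEq V] [Fintype W] [DecidableEq W]

/-- The sum `(J a)_v = Σ_{w ∈ ∂v} a_{w⁺}/|b_w|`. -/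
noncomputable def neighborSum (X : LabeledGraph V W) (a : V → ℝ) (v : V) : ℝ :=
  ∑ w ∈ univ.filter (fun w => X.ini w = v), a (X.ter w) / (X.b w : ℝ)

lemma b_cast_pos (X : LabeledGraph V W) (w : W) : (0 : ℝ) < X.b w := by
  exact_mod_cast X.b_pos w

lemma Aplus_mulVec (X : LabeledGraph V W) (x : V → ℝ) (v : V) :
    X.Aplus.mulVec x v = |X.k v| * x v - X.neighborSum x v := by
  simp only [Aplus, Matrix.mulVec, dotProduct, Matrix.of_apply, sub_mul, Finset.sum_sub_distrib,
    ite_mul, zero_mul, Finset.sum_ite_eq, Finset.mem_univ, if_true, neighborSum]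
  congr 1
  rw [← Finset.sum_fiberwise (univ.filter fun w => X.ini w = v) X.ter]
  refine Finset.sum_congr rfl fun u _ => ?_
  rw [Finset.sum_mul, Finset.filter_filter]
  refine Finset.sum_congr rfl fun w hw => ?_
  rw [(Finset.mem_filter.1 hw).2.2]
  ring

lemma Aplus_transpose (X : LabeledGraph V W) : X.Aplus.transpose = X.Aplus := by
  ext v u
  simp only [Aplus, Matrix.transpose_apply, Matrix.of_apply]
  congr 1
  · by_cases h : u = v
    · simp [h]
    · simp [h, Ne.symm h]
  · refine Finset.sum_nbij' X.rev X.rev ?_ ?_ ?_ ?_ ?_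
    · intro w hw
      rw [Finset.mem_filter_univ] at hw ⊢
      simpa [ter, X.rev_invol, and_comm] using hw
    · intro w hw
      rw [Finset.mem_filter_univ] at hw ⊢
      simpa [ter, X.rev_invol, and_comm] using hw
    · intro w _
      exact X.rev_invol w
    · intro w _
      exact X.rev_invol w
    · intro w _
      rw [X.b_symm]

lemma dotProduct_Aplus_mulVec_comm (X : LabeledGraph V W) (x y : V → ℝ) :
    x ⬝ᵥ X.Aplus.mulVec y = y ⬝ᵥ X.Aplus.mulVec x := by
  rw [Matrix.dotProduct_mulVec, ← Matrix.mulVec_transpose, Aplus_transpose, dotProduct_comm]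

lemma dotProduct_Aplus_mulVec_abs_le (X : LabeledGraph V W) (x : V → ℝ) :
    |x| ⬝ᵥ X.Aplus.mulVec |x| ≤ x ⬝ᵥ X.Aplus.mulVec x := by
  refine Finset.sum_le_sum fun v _ => ?_
  rw [Aplus_mulVec, Aplus_mulVec, mul_sub, mul_sub]
  have hdiag : |x| v * (|X.k v| * |x| v) = x v * (|X.k v| * x v) := by
    rw [Pi.abs_apply]
    linear_combination |X.k v| * abs_mul_abs_self (x v)
  have hoff : x v * X.neighborSum x v ≤ |x| v * X.neighborSum |x| v := by
    simp only [neighborSum, Finset.mul_sum]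
    refine Finset.sum_le_sum fun w _ => ?_
    rw [← mul_div_assoc, ← mul_div_assoc]
    refine div_le_div_of_nonneg_right ?_ (X.b_cast_pos w).le
    rw [Pi.abs_apply, Pi.abs_apply, ← abs_mul]
    exact le_abs_self _
  linarith

/-- A property that passes along edges holds everywhere once it holds at one vertex. -/
lemma forall_of_edge (X : LabeledGraph V W) {P : V → Prop}
    (hP : ∀ w, P (X.ini w) → P (X.ter w)) {u : V} (hu : P u) (v : V) : P v := by
  induction X.connected u v with
  | refl => exact hu
  | tail _ h ih =>
    obtain ⟨w, rfl, rfl⟩ := h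
    exact hP w ih

lemma exists_ini_eq (X : LabeledGraph V W) (v : V) : ∃ w, X.ini w = v := by
  obtain ⟨w⟩ := X.edges_nonempty
  exact X.forall_of_edge (P := fun v => ∃ w, X.ini w = v) (fun w _ => ⟨X.rev w, rfl⟩) ⟨w, rfl⟩ v

lemma pos_of_eigenvector (X : LabeledGraph V W) {a : V → ℝ} {μ : ℝ} (ha : ∀ v, 0 ≤ a v)
    (ha0 : a ≠ 0) (h : X.Aplus.mulVec a = μ • a) (v : V) : 0 < a v := by
  refine (ha v).lt_of_ne' fun hv => ha0 (funext fun u => ?_)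
  refine X.forall_of_edge (P := fun v => a v = 0) (fun w hw => ?_) hv u
  have hsum : X.neighborSum a (X.ini w) = 0 := by
    have := congrFun h (X.ini w)
    rw [Aplus_mulVec, Pi.smul_apply, hw] at this
    simpa using this
  have := (Finset.sum_eq_zero_iff_of_nonneg
    (fun w' _ => div_nonneg (ha (X.ter w')) (X.b_cast_pos w').le)).1 hsum w (by simp)
  exact (div_eq_zero_iff.1 this).resolve_right (X.b_cast_pos w).ne'

lemma neighborSum_pos (X : LabeledGraph V W) {a : V → ℝ} (ha : ∀ v, 0 < a v) (v : V) :
    0 < X.neighborSum a v := by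
  obtain ⟨w, hw⟩ := X.exists_ini_eq v
  exact Finset.sum_pos (fun w' _ => div_pos (ha _) (X.b_cast_pos w')) ⟨w, by simp [hw]⟩

lemma dotProduct_self_pos {ι : Type*} [Fintype ι] {x : ι → ℝ} (hx : x ≠ 0) : 0 < x ⬝ᵥ x := by
  simpa using Matrix.dotProduct_star_self_pos_iff.2 hx

/-- Every real quadratic form attains the minimum of its Rayleigh quotient. -/
lemma exists_rayleigh_minimizer [Nonempty V] (A : Matrix V V ℝ) :
    ∃ (μ : ℝ) (x : V → ℝ), x ≠ 0 ∧ x ⬝ᵥ A.mulVec x = μ * (x ⬝ᵥ x) ∧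
      ∀ y : V → ℝ, μ * (y ⬝ᵥ y) ≤ y ⬝ᵥ A.mulVec y := by
  have hcont : Continuous fun x : V → ℝ => x ⬝ᵥ x := by fun_prop
  have hcompact : IsCompact {x : V → ℝ | x ⬝ᵥ x = 1} := by
    refine Metric.isCompact_of_isClosed_isBounded (isClosed_eq hcont continuous_const) ?_
    refine (Metric.isBounded_closedBall (x := (0 : V → ℝ)) (r := 1)).subset fun x hx => ?_
    rw [mem_closedBall_zero_iff, pi_norm_le_iff_of_nonneg zero_le_one]
    intro v
    have hle : x v * x v ≤ x ⬝ᵥ x :=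
      Finset.single_le_sum (f := fun v => x v * x v) (fun u _ => mul_self_nonneg (x u))
        (Finset.mem_univ v)
    rw [show x ⬝ᵥ x = 1 from hx] at hle
    rw [Real.norm_eq_abs]
    exact abs_le_one_iff_mul_self_le_one.2 hle
  obtain ⟨v₀⟩ := ‹Nonempty V›
  obtain ⟨x, hx, hmin⟩ := hcompact.exists_isMinOn ⟨Pi.single v₀ 1, by simp⟩
    (f := fun x : V → ℝ => x ⬝ᵥ A.mulVec x) (by fun_prop)
  have hx1 : x ⬝ᵥ x = 1 := hx
  refine ⟨x ⬝ᵥ A.mulVec x, x, ?_, by rw [hx1, mul_one], fun y => ?_⟩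
  · rintro rfl
    simp at hx1
  · by_cases hy : y = 0
    · simp [hy]
    have hpos := dotProduct_self_pos hy
    set r := Real.sqrt (y ⬝ᵥ y) with hr
    have hr0 : 0 < r := Real.sqrt_pos.2 hpos
    have hrr : r * r = y ⬝ᵥ y := Real.mul_self_sqrt hpos.le
    have hmem : (r⁻¹ • y) ⬝ᵥ (r⁻¹ • y) = 1 := by
      simp only [smul_dotProduct, dotProduct_smul, smul_eq_mul, ← hrr]
      field_simp
    have hle : x ⬝ᵥ A.mulVec x ≤ (r⁻¹ • y) ⬝ᵥ A.mulVec (r⁻¹ • y) := hmin hmem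
    simp only [Matrix.mulVec_smul, smul_dotProduct, dotProduct_smul, smul_eq_mul] at hle
    calc x ⬝ᵥ A.mulVec x * (y ⬝ᵥ y)
        ≤ r⁻¹ * (r⁻¹ * (y ⬝ᵥ A.mulVec y)) * (y ⬝ᵥ y) := mul_le_mul_of_nonneg_right hle hpos.le
      _ = y ⬝ᵥ A.mulVec y := by
        rw [← hrr]
        field_simp

/-- The least eigenvalue of `A⁺` has an everywhere positive eigenvector. -/
lemma exists_pos_ground_state (X : LabeledGraph V W) :
    ∃ (μ : ℝ) (a : V → ℝ), (∀ v, 0 < a v) ∧ X.Aplus.mulVec a = μ • a ∧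
      ∀ y : V → ℝ, μ * (y ⬝ᵥ y) ≤ y ⬝ᵥ X.Aplus.mulVec y := by
  have : Nonempty V := X.edges_nonempty.map X.ini
  obtain ⟨μ, x, hx0, hx, hmin⟩ := exists_rayleigh_minimizer X.Aplus
  have hform (y : V → ℝ) : y ⬝ᵥ (X.Aplus - μ • (1 : Matrix V V ℝ)).mulVec y =
      y ⬝ᵥ X.Aplus.mulVec y - μ * (y ⬝ᵥ y) := by
    simp [Matrix.sub_mulVec, Matrix.smul_mulVec, dotProduct_sub]
  have hpsd : (X.Aplus - μ • (1 : Matrix V V ℝ)).PosSemidef := by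
    refine Matrix.PosSemidef.of_dotProduct_mulVec_nonneg ?_ fun y => ?_
    · rw [Matrix.IsHermitian, Matrix.conjTranspose_eq_transpose_of_trivial]
      simp [Aplus_transpose]
    · rw [star_trivial, hform]
      linarith [hmin y]
  have habs : |x| ⬝ᵥ |x| = x ⬝ᵥ x := by
    simp [dotProduct]
  have hzero : |x| ⬝ᵥ (X.Aplus - μ • (1 : Matrix V V ℝ)).mulVec |x| = 0 := by
    rw [hform]
    have h₁ := X.dotProduct_Aplus_mulVec_abs_le x
    have h₂ := hmin |x|
    rw [habs] at h₂ ⊢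
    linarith
  have heig : X.Aplus.mulVec |x| = μ • |x| := by
    have h := (hpsd.dotProduct_mulVec_zero_iff |x|).1 (by rwa [star_trivial])
    rw [Matrix.sub_mulVec, Matrix.smul_mulVec, Matrix.one_mulVec] at h
    exact sub_eq_zero.1 h
  exact ⟨μ, |x|, X.pos_of_eigenvector (fun v => abs_nonneg (x v)) (by simpa using hx0) heig,
    heig, hmin⟩

lemma BKN_of_ini (X : LabeledGraph V W) {a c : V → ℝ}
    (h : ∀ v, X.k v * a v = c v * X.neighborSum a v) :
    X.BKN a fun w => c (X.ini w) := by
  intro v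
  rw [h v, neighborSum, Finset.mul_sum]
  refine Finset.sum_congr rfl fun w hw => ?_
  simp only [(Finset.mem_filter.1 hw).2]
  ring

/-- A positive vector with `(A⁺ a)_v < 0` at every vertex yields a compatible solution. -/
lemma exists_compatible_of_lt (X : LabeledGraph V W) {a : V → ℝ} (ha : ∀ v, 0 < a v)
    (h : ∀ v, |X.k v| * a v < X.neighborSum a v) :
    ∃ (a : V → ℝ) (γ : W → ℝ), X.BKN a γ ∧ X.Compatible a γ := by
  have hS := X.neighborSum_pos ha
  have hlt (v : V) : |X.k v * a v / X.neighborSum a v| < 1 := by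
    rw [abs_div, abs_of_pos (hS v), div_lt_one (hS v), abs_mul, abs_of_pos (ha v)]
    exact h v
  refine ⟨a, _, X.BKN_of_ini (c := fun v => X.k v * a v / X.neighborSum a v) fun v =>
    (div_mul_cancel₀ _ (hS v).ne').symm, fun v => (ha v).le, ?_, fun w => (hlt _).le, ?_,
    fun v hv => absurd hv (ha v).ne'⟩
  · obtain ⟨w⟩ := X.edges_nonempty
    exact fun h0 => (ha (X.ini w)).ne' (congrFun h0 _)
  · intro w hw
    rw [abs_mul] at hw
    exact absurd hw (mul_lt_one_of_nonneg_of_lt_one_left (abs_nonneg _) (hlt _) (hlt _).le).ne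

lemma exists_compatible_of_eq (X : LabeledGraph V W) {a : V → ℝ} (ha : ∀ v, 0 < a v) {ε : ℝ}
    (hε : |ε| = 1) (h : ∀ v, X.k v * a v = ε * X.neighborSum a v) :
    ∃ (a : V → ℝ) (γ : W → ℝ), X.BKN a γ ∧ X.Compatible a γ := by
  refine ⟨a, _, X.BKN_of_ini (c := fun _ => ε) h, fun v => (ha v).le, ?_, fun _ => hε.le,
    fun _ _ => rfl, fun v hv => absurd hv (ha v).ne'⟩
  obtain ⟨w⟩ := X.edges_nonempty
  exact fun h0 => (ha (X.ini w)).ne' (congrFun h0 _)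

lemma abs_k_mul_le_neighborSum (X : LabeledGraph V W) {a : V → ℝ} {γ : W → ℝ} (h : X.BKN a γ)
    (ha : ∀ v, 0 ≤ a v) (hγ : ∀ w, |γ w| ≤ 1) (v : V) :
    |X.k v| * a v ≤ X.neighborSum a v := by
  rw [← abs_of_nonneg (ha v), ← abs_mul, h v]
  refine (Finset.abs_sum_le_sum_abs _ _).trans (Finset.sum_le_sum fun w _ => ?_)
  rw [abs_mul, abs_div, abs_of_pos (X.b_cast_pos w), abs_of_nonneg (ha _), div_mul_eq_mul_div]
  exact div_le_div_of_nonneg_right (mul_le_of_le_one_left (ha _) (hγ w)) (X.b_cast_pos w).le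

/-- If the bound `|k_v| a_v ≤ (J a)_v` is attained, then all angles at `v` equal `ε`, the sign
of the charge. -/
lemma angle_eq_of_eq_neighborSum (X : LabeledGraph V W) {a : V → ℝ} {γ : W → ℝ} (h : X.BKN a γ)
    (ha : ∀ v, 0 < a v) (hγ : ∀ w, |γ w| ≤ 1) {ε : ℝ} (hε : |ε| = 1) (w : W)
    (heq : ε * X.k (X.ini w) * a (X.ini w) = X.neighborSum a (X.ini w)) :
    ε * γ w = 1 := by
  rw [mul_assoc, h (X.ini w), neighborSum, Finset.mul_sum] at heq
  have hle : ∀ w', ε * γ w' ≤ 1 := fun w' =>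
    (le_abs_self _).trans (by rw [abs_mul, hε, one_mul]; exact hγ w')
  have hterm := (Finset.sum_eq_sum_iff_of_le (fun w' _ => by
    rw [div_mul_eq_mul_div, ← mul_div_assoc, ← mul_assoc]
    exact div_le_div_of_nonneg_right (mul_le_of_le_one_left (ha _).le (hle w'))
      (X.b_cast_pos w').le)).1 heq w (by simp)
  have hb := (X.b_cast_pos w).ne'
  have ha' := (ha (X.ter w)).ne'
  field_simp at hterm
  linarith

/-- When the bound is attained everywhere, all charges have one and the same sign. -/
lemma k_same_sign (X : LabeledGraph V W) {a : V → ℝ} {γ : W → ℝ} (h : X.BKN a γ)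
    (hc : X.Compatible a γ) (ha : ∀ v, 0 < a v)
    (heq : ∀ v, |X.k v| * a v = X.neighborSum a v) :
    (∀ v, 0 < X.k v) ∨ (∀ v, X.k v < 0) := by
  obtain ⟨-, -, hγ, hsym, -⟩ := hc
  have hk (v : V) : X.k v ≠ 0 := by
    intro h0
    have := X.neighborSum_pos ha v
    rw [← heq v, h0] at this
    simp at this
  have hpos (w : W) (hw : 0 < X.k (X.ini w)) : γ w = 1 := by
    have := X.angle_eq_of_eq_neighborSum h ha hγ (ε := 1) (by simp) w
      (by rw [← heq, abs_of_pos hw, one_mul])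
    linarith
  have hneg (w : W) (hw : X.k (X.ini w) < 0) : γ w = -1 := by
    have := X.angle_eq_of_eq_neighborSum h ha hγ (ε := -1) (by simp) w
      (by rw [← heq, abs_of_neg hw, neg_one_mul])
    linarith
  obtain ⟨w₀⟩ := X.edges_nonempty
  rcases (hk (X.ini w₀)).lt_or_gt with h0 | h0
  · refine Or.inr (X.forall_of_edge (fun w hw => ?_) h0)
    by_contra hcon
    have h₁ := hneg w hw
    have h₂ := hpos (X.rev w) ((hk _).lt_of_le' (not_lt.1 hcon))
    have := hsym w (by rw [h₁, h₂]; simp)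
    linarith
  · refine Or.inl (X.forall_of_edge (fun w hw => ?_) h0)
    by_contra hcon
    have h₁ := hpos w hw
    have h₂ := hneg (X.rev w) ((hk _).lt_of_le (not_lt.1 hcon))
    have := hsym w (by rw [h₁, h₂]; simp)
    linarith

end LabeledGraph

open LabeledGraph in
/-- Spectral criterion for (I)=(HI): the BKN-equation over `X` has a compatible solution iff
either (1) all charges are nonzero of one and the same sign and `A⁺` is positive
semidefinite and singular, or (2) `A⁺` has a negative real eigenvalue. -/
theorem compatible_solution_iff_spectral
    {V W : Type} [Fintype V] [DecidableEq V] [Fintype W] [DecidableEq W]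
    (X : LabeledGraph V W) :
    (∃ (a : V → ℝ) (γ : W → ℝ), X.BKN a γ ∧ X.Compatible a γ) ↔
      (((∀ v, 0 < X.k v) ∨ (∀ v, X.k v < 0)) ∧
        PosSemidef' X.Aplus ∧ Singular X.Aplus) ∨
      HasNegEigenvalue X.Aplus := by
  have : Nonempty V := X.edges_nonempty.map X.ini
  obtain ⟨μ, e, he, hAe, hmin⟩ := X.exists_pos_ground_state
  have he0 : e ≠ 0 := fun h => (he (Classical.arbitrary V)).ne' (congrFun h _)
  constructor
  · rintro ⟨a, γ, hB, hC⟩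
    obtain ⟨ha, ha0, hγ, -⟩ := id hC
    have hle (v : V) : X.Aplus.mulVec a v ≤ 0 := by
      rw [Aplus_mulVec]
      linarith [X.abs_k_mul_le_neighborSum hB ha hγ v]
    have hμ : μ ≤ 0 := by
      have h : a ⬝ᵥ X.Aplus.mulVec a ≤ 0 :=
        Finset.sum_nonpos fun v _ => mul_nonpos_of_nonneg_of_nonpos (ha v) (hle v)
      nlinarith [hmin a, dotProduct_self_pos ha0]
    rcases hμ.lt_or_eq with hμ | rfl
    · exact Or.inr ⟨μ, hμ, e, he0, hAe⟩
    · rw [zero_smul] at hAe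
      have hsum : e ⬝ᵥ X.Aplus.mulVec a = 0 := by
        rw [dotProduct_Aplus_mulVec_comm, hAe, dotProduct_zero]
      have hAa (v : V) : X.Aplus.mulVec a v = 0 :=
        (mul_eq_zero.1 ((Finset.sum_eq_zero_iff_of_nonpos fun v _ =>
          mul_nonpos_of_nonneg_of_nonpos (he v).le (hle v)).1 hsum v
            (Finset.mem_univ v))).resolve_left (he v).ne'
      have hpos := X.pos_of_eigenvector (μ := 0) ha ha0 (by rw [zero_smul]; exact funext hAa)
      refine Or.inl ⟨X.k_same_sign hB hC hpos fun v => ?_, fun x => ?_, e, he0, hAe⟩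
      · exact sub_eq_zero.1 ((X.Aplus_mulVec a v).symm.trans (hAa v))
      · simpa using hmin x
  · have hval (v : V) : |X.k v| * e v = μ * e v + X.neighborSum e v := by
      have h := congrFun hAe v
      rw [Aplus_mulVec, Pi.smul_apply, smul_eq_mul] at h
      linarith
    rintro (⟨hk, hpsd, x, hx0, hx⟩ | ⟨ν, hν, x, hx0, hx⟩)
    · have hμ₁ : μ ≤ 0 := by
        have h := hmin x
        rw [hx, dotProduct_zero] at h
        nlinarith [dotProduct_self_pos hx0]
      have hμ₂ : 0 ≤ μ := by
        have h := hpsd e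
        rw [hAe, dotProduct_smul, smul_eq_mul] at h
        exact nonneg_of_mul_nonneg_left h (dotProduct_self_pos he0)
      obtain rfl := le_antisymm hμ₁ hμ₂
      rcases hk with hk | hk
      · refine X.exists_compatible_of_eq he (ε := 1) (by simp) fun v => ?_
        have h := hval v
        rw [abs_of_pos (hk v)] at h
        linarith
      · refine X.exists_compatible_of_eq he (ε := -1) (by simp) fun v => ?_
        have h := hval v
        rw [abs_of_neg (hk v)] at h
        linarith
    · have hμ : μ < 0 := by
        have h := hmin x
        rw [hx, dotProduct_smul, smul_eq_mul] at h
        exact (le_of_mul_le_mul_right h (dotProduct_self_pos hx0)).trans_lt hν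
      refine X.exists_compatible_of_lt he fun v => ?_
      rw [hval v]
      linarith [mul_neg_of_neg_of_pos hμ (he v)]
end

section
/- Let X be a labeled graph such that either all charges of X are zero or at least one charge is positive, let s be an admissible sign function for X and H the associated operator. Then the BKN-equation over X has a compatible symmetric solution if and only if H has a nonpositive real eigenvalue. -/
open Finset Matrix

namespace Matrix

variable {V : Type*} [Fintype V]

/-- A Hermitian real matrix whose quadratic form is nonpositive at some nonzero vector has a
nonpositive eigenvalue. -/
theorem IsHermitian.exists_nonpos_eigenvalue [DecidableEq V] {A : Matrix V V ℝ} (hA : A.IsHermitian)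
    {x : V → ℝ} (hx : x ≠ 0) (h : x ⬝ᵥ A *ᵥ x ≤ 0) :
    ∃ μ : ℝ, μ ≤ 0 ∧ ∃ y : V → ℝ, y ≠ 0 ∧ A *ᵥ y = μ • y := by
  by_contra! hcon
  have hpos : A.PosDef := by
    rw [hA.posDef_iff_eigenvalues_pos]
    intro i
    by_contra! hi
    refine hcon _ hi (hA.eigenvectorBasis i) ?_ (hA.mulVec_eigenvectorBasis i)
    intro h0
    have hn := hA.eigenvectorBasis.orthonormal.ne_zero i
    exact hn (by ext j; exact congrFun h0 j)
  have := hpos.dotProduct_mulVec_pos hx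
  rw [star_trivial] at this
  linarith

theorem dotProduct_mulVec_eq_sum (M : Matrix V V ℝ) (x : V → ℝ) :
    x ⬝ᵥ M *ᵥ x = ∑ i, ∑ j, x i * (M i j * x j) := by
  simp [dotProduct, mulVec, Finset.mul_sum]

theorem dotProduct_diagonal_mulVec_self [DecidableEq V] (D x : V → ℝ) :
    x ⬝ᵥ diagonal D *ᵥ x = ∑ v, D v * x v ^ 2 := by
  simp only [dotProduct, mulVec_diagonal]
  exact Finset.sum_congr rfl fun v _ => by ring

/-- For a positive diagonal form dominated at some vector by a symmetric form with nonnegative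
entries, a suitable rescaling of the latter makes the difference singular, with a nonnegative
kernel vector. -/
theorem exists_nonneg_generalized_eigenvector {D : V → ℝ} (hD : ∀ v, 0 < D v)
    {J : Matrix V V ℝ} (hJ : J.IsHermitian) (hnn : ∀ i j, 0 ≤ J i j) {x : V → ℝ} (hx : x ≠ 0)
    (h : ∑ v, D v * x v ^ 2 ≤ x ⬝ᵥ J *ᵥ x) :
    ∃ t : ℝ, 0 ≤ t ∧ t ≤ 1 ∧ ∃ a : V → ℝ, (∀ v, 0 ≤ a v) ∧ a ≠ 0 ∧
      ∀ v, D v * a v = t * (J *ᵥ a) v := by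
  classical
  have hQpos : ∀ y : V → ℝ, y ≠ 0 → 0 < ∑ v, D v * y v ^ 2 := by
    intro y hy
    obtain ⟨v, hv⟩ := Function.ne_iff.mp hy
    have hv' : y v ≠ 0 := hv
    exact Finset.sum_pos' (fun i _ => mul_nonneg (hD i).le (sq_nonneg _))
      ⟨v, Finset.mem_univ v, mul_pos (hD v) (by positivity)⟩
  have hne : ∀ y ∈ stdSimplex ℝ V, y ≠ 0 := by
    rintro y hy rfl
    simpa using hy.2
  obtain ⟨v₀, hv₀⟩ := Function.ne_iff.mp hx
  obtain ⟨a, ha, hmax⟩ := (isCompact_stdSimplex ℝ V).exists_isMaxOn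
    (f := fun y : V → ℝ => (∑ i, ∑ j, y i * (J i j * y j)) / ∑ v, D v * y v ^ 2)
    ⟨_, single_mem_stdSimplex ℝ v₀⟩
    (ContinuousOn.div (by fun_prop) (by fun_prop) fun y hy => (hQpos y (hne y hy)).ne')
  set M := (∑ i, ∑ j, a i * (J i j * a j)) / ∑ v, D v * a v ^ 2 with hM
  have hbound : ∀ y : V → ℝ, y ⬝ᵥ J *ᵥ y ≤ M * ∑ v, D v * y v ^ 2 := by
    intro y
    by_cases hy : y = 0
    · simp [hy]
    have hS : 0 < ∑ v, |y v| := by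
      obtain ⟨v, hv⟩ := Function.ne_iff.mp hy
      exact Finset.sum_pos' (fun i _ => abs_nonneg _) ⟨v, Finset.mem_univ v, abs_pos.mpr hv⟩
    set S := ∑ v, |y v| with hSdef
    have hz : (fun v => |y v| / S) ∈ stdSimplex ℝ V :=
      ⟨fun v => div_nonneg (abs_nonneg _) hS.le, by rw [← Finset.sum_div, div_self hS.ne']⟩
    have h1 := hmax hz
    simp only [Set.mem_ofPred_eq] at h1
    rw [← hM, div_le_iff₀ (hQpos _ (hne _ hz))] at h1
    have e1 : ∑ i, ∑ j, |y i| / S * (J i j * (|y j| / S))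
        = (∑ i, ∑ j, |y i| * (J i j * |y j|)) / S ^ 2 := by
      simp only [Finset.sum_div]
      exact Finset.sum_congr rfl fun i _ => Finset.sum_congr rfl fun j _ => by ring
    have e2 : ∑ v, D v * (|y v| / S) ^ 2 = (∑ v, D v * y v ^ 2) / S ^ 2 := by
      simp only [Finset.sum_div, div_pow, sq_abs]
      exact Finset.sum_congr rfl fun i _ => by ring
    rw [e1, e2, ← mul_div_assoc, div_le_div_iff_of_pos_right (by positivity)] at h1
    refine le_trans ?_ h1
    rw [dotProduct_mulVec_eq_sum]
    refine Finset.sum_le_sum fun i _ => Finset.sum_le_sum fun j _ => ?_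
    calc y i * (J i j * y j) ≤ |y i * (J i j * y j)| := le_abs_self _
      _ = |y i| * (J i j * |y j|) := by rw [abs_mul, abs_mul, abs_of_nonneg (hnn i j)]
  have hM1 : 1 ≤ M := by
    have h1 := hQpos x hx
    have h2 := hbound x
    by_contra! hlt
    nlinarith
  have hpsd : (M • diagonal D - J).PosSemidef := by
    refine PosSemidef.of_dotProduct_mulVec_nonneg ?_ fun y => ?_
    · refine IsHermitian.sub ?_ hJ
      ext i j
      by_cases hij : i = j
      · simp [hij]
      · simp [hij, Ne.symm hij]
    · rw [star_trivial, sub_mulVec, dotProduct_sub, smul_mulVec, dotProduct_smul,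
        dotProduct_diagonal_mulVec_self, smul_eq_mul]
      linarith [hbound y]
  have hzero : (M • diagonal D - J) *ᵥ a = 0 := by
    rw [← hpsd.dotProduct_mulVec_zero_iff, star_trivial, sub_mulVec, dotProduct_sub,
      smul_mulVec, dotProduct_smul, dotProduct_diagonal_mulVec_self, smul_eq_mul,
      dotProduct_mulVec_eq_sum, hM, div_mul_cancel₀ _ (hQpos a (hne a ha)).ne', sub_self]
  refine ⟨M⁻¹, by positivity, inv_le_one_of_one_le₀ hM1, a, ha.1, hne a ha, fun v => ?_⟩
  have := congrFun hzero v
  simp only [sub_mulVec, smul_mulVec, Pi.sub_apply, Pi.smul_apply, mulVec_diagonal,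
    smul_eq_mul, Pi.zero_apply] at this
  field_simp
  linarith

end Matrix

namespace LabeledGraph

variable {V W : Type} [Fintype V] [DecidableEq V] [Fintype W] [DecidableEq W]

/-- The weighted adjacency matrix of `X` with weight `c w` on the oriented edge `w`. -/
def weightedAdj (X : LabeledGraph V W) (c : W → ℝ) : Matrix V V ℝ :=
  Matrix.of fun v v' => ∑ w ∈ univ.filter (fun w => X.ini w = v ∧ X.ter w = v'), c w

open scoped Classical in
/-- The weight `1/|b_w|` on oriented edges inside a sign component, and `0` elsewhere. -/
noncomputable def innerWeight (X : LabeledGraph V W) (w : W) : ℝ :=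
  if X.SameSign (X.ini w) (X.ter w) then 1 / (X.b w : ℝ) else 0

theorem ini_rev (X : LabeledGraph V W) (w : W) : X.ini (X.rev w) = X.ter w := rfl

theorem ter_rev (X : LabeledGraph V W) (w : W) : X.ter (X.rev w) = X.ini w := by
  rw [ter, X.rev_invol]

theorem sum_rev (X : LabeledGraph V W) (f : W → ℝ) : ∑ w, f (X.rev w) = ∑ w, f w :=
  Equiv.sum_comp (Function.Involutive.toPerm X.rev X.rev_invol) f

theorem sum_ini_fiber (X : LabeledGraph V W) (g : V → ℝ) (f : W → ℝ) :
    ∑ v, g v * ∑ w ∈ univ.filter (fun w => X.ini w = v), f w = ∑ w, g (X.ini w) * f w := by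
  simp only [Finset.mul_sum]
  rw [← Finset.sum_fiberwise univ X.ini fun w => g (X.ini w) * f w]
  refine Finset.sum_congr rfl fun v _ => Finset.sum_congr rfl fun w hw => ?_
  rw [(Finset.mem_filter.mp hw).2]

theorem weightedAdj_mulVec (X : LabeledGraph V W) (c : W → ℝ) (x : V → ℝ) (v : V) :
    (X.weightedAdj c *ᵥ x) v
      = ∑ w ∈ univ.filter (fun w => X.ini w = v), c w * x (X.ter w) := by
  simp only [mulVec, dotProduct, weightedAdj, Matrix.of_apply, Finset.sum_mul]
  rw [← Finset.sum_fiberwise (univ.filter fun w => X.ini w = v) X.ter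
    fun w => c w * x (X.ter w)]
  refine Finset.sum_congr rfl fun u _ => ?_
  rw [Finset.filter_filter]
  refine Finset.sum_congr rfl fun w hw => ?_
  rw [(Finset.mem_filter.mp hw).2.2]

theorem dotProduct_weightedAdj_mulVec (X : LabeledGraph V W) (c : W → ℝ) (x : V → ℝ) :
    x ⬝ᵥ X.weightedAdj c *ᵥ x = ∑ w, x (X.ini w) * (c w * x (X.ter w)) := by
  simp only [dotProduct, weightedAdj_mulVec]
  exact X.sum_ini_fiber x _

theorem weightedAdj_isHermitian (X : LabeledGraph V W) {c : W → ℝ}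
    (hc : ∀ w, c (X.rev w) = c w) : (X.weightedAdj c).IsHermitian := by
  ext i j
  simp only [conjTranspose_apply, weightedAdj, Matrix.of_apply, star_trivial,
    Finset.sum_filter]
  rw [← X.sum_rev]
  simp only [hc, ini_rev, ter_rev, and_comm]

theorem sameSign_symm (X : LabeledGraph V W) {u v : V} (h : X.SameSign u v) :
    X.SameSign v u := by
  refine Relation.ReflTransGen.mono ?_ _ _ (Relation.reflTransGen_swap.mpr h)
  rintro x y ⟨⟨w, rfl, rfl⟩, hk⟩
  exact ⟨⟨X.rev w, X.ini_rev w, X.ter_rev w⟩, by rwa [mul_comm]⟩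

theorem innerWeight_rev (X : LabeledGraph V W) (w : W) :
    X.innerWeight (X.rev w) = X.innerWeight w := by
  have h : X.SameSign (X.ini (X.rev w)) (X.ter (X.rev w)) ↔
      X.SameSign (X.ini w) (X.ter w) := by
    rw [ini_rev, ter_rev]
    exact ⟨X.sameSign_symm, X.sameSign_symm⟩
  by_cases hw : X.SameSign (X.ini w) (X.ter w)
  · rw [innerWeight, innerWeight, if_pos hw, if_pos (h.mpr hw), X.b_symm]
  · rw [innerWeight, innerWeight, if_neg hw, if_neg (mt h.mp hw)]

theorem innerWeight_nonneg (X : LabeledGraph V W) (w : W) : 0 ≤ X.innerWeight w := by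
  unfold innerWeight
  split_ifs <;> positivity

theorem Hop_eq (X : LabeledGraph V W) (s : V → ℝ) :
    X.Hop s = diagonal (fun v => s v * X.k v) - X.weightedAdj X.innerWeight := by
  ext i j
  simp only [Hop, weightedAdj, innerWeight, Matrix.of_apply, Matrix.sub_apply,
    Matrix.diagonal_apply, ← Finset.sum_filter, Finset.filter_filter]
  congr! 3
  simp only [and_assoc]

theorem Hop_isHermitian (X : LabeledGraph V W) (s : V → ℝ) : (X.Hop s).IsHermitian := by
  rw [Hop_eq]
  exact (Matrix.isHermitian_diagonal _).sub (X.weightedAdj_isHermitian X.innerWeight_rev)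

theorem dotProduct_Hop_mulVec (X : LabeledGraph V W) (s x : V → ℝ) :
    x ⬝ᵥ X.Hop s *ᵥ x = ∑ v, s v * X.k v * x v ^ 2
      - ∑ w, x (X.ini w) * (X.innerWeight w * x (X.ter w)) := by
  rw [Hop_eq, sub_mulVec, dotProduct_sub, dotProduct_diagonal_mulVec_self,
    dotProduct_weightedAdj_mulVec]

theorem sum_innerWeight_nonneg (X : LabeledGraph V W) {a : V → ℝ} (ha : ∀ v, 0 ≤ a v) :
    0 ≤ ∑ w, a (X.ini w) * (X.innerWeight w * a (X.ter w)) :=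
  Finset.sum_nonneg fun w _ => mul_nonneg (ha _) (mul_nonneg (X.innerWeight_nonneg w) (ha _))

/-- A compatible symmetric solution makes the quadratic form of `H` nonpositive. -/
theorem dotProduct_Hop_mulVec_nonpos (X : LabeledGraph V W) {s : V → ℝ} (hs : X.Admissible s)
    {a : V → ℝ} {γ : W → ℝ} (hbkn : X.BKN a γ) (ha : ∀ v, 0 ≤ a v) (hγ : ∀ w, |γ w| ≤ 1)
    (hsym : X.SymSol γ) : a ⬝ᵥ X.Hop s *ᵥ a ≤ 0 := by
  rw [dotProduct_Hop_mulVec]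
  rcases hs with ⟨h1, h2, h3, -⟩ | ⟨rfl, -⟩
  · set f : W → ℝ := fun w => s (X.ini w) * a (X.ini w) * (γ w / (X.b w : ℝ) * a (X.ter w))
      with hf
    have hsum : ∑ v, s v * X.k v * a v ^ 2 = ∑ w, f w := by
      rw [hf, ← X.sum_ini_fiber (fun v => s v * a v)]
      refine Finset.sum_congr rfl fun v _ => ?_
      rw [← hbkn v]
      ring
    have hpt : ∀ w, f w + f (X.rev w)
        ≤ 2 * (a (X.ini w) * (X.innerWeight w * a (X.ter w))) := by
      intro w
      simp only [hf, ini_rev, ter_rev, X.b_symm, hsym w]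
      by_cases hw : X.SameSign (X.ini w) (X.ter w)
      · rw [innerWeight, if_pos hw, ← h2 _ _ hw]
        have hsγ : s (X.ini w) * γ w ≤ 1 := by
          have := abs_le.mp (hγ w)
          rcases h1 (X.ini w) with h | h <;> rw [h] <;> linarith
        have hnn : 0 ≤ a (X.ini w) * a (X.ter w) / X.b w :=
          div_nonneg (mul_nonneg (ha _) (ha _)) (Nat.cast_nonneg _)
        calc _ = 2 * (s (X.ini w) * γ w * (a (X.ini w) * a (X.ter w) / X.b w)) := by ring
          _ ≤ 2 * (1 * (a (X.ini w) * a (X.ter w) / X.b w)) := by gcongr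
          _ = _ := by ring
      · rw [innerWeight, if_neg hw, h3 w hw]
        exact le_of_eq (by ring)
    have htot := Finset.sum_le_sum fun w (_ : w ∈ univ) => hpt w
    rw [Finset.sum_add_distrib, X.sum_rev, ← Finset.mul_sum] at htot
    linarith
  · simpa using X.sum_innerWeight_nonneg ha

theorem mul_pos_of_sameSign (X : LabeledGraph V W) (hk : ∀ v, X.k v ≠ 0) {u v : V}
    (h : X.SameSign u v) : 0 < X.k u * X.k v := by
  induction h with
  | refl => exact mul_self_pos.mpr (hk u)
  | tail _ hbc ih =>
    rcases pos_and_pos_or_neg_and_neg_of_mul_pos ih with h | h <;>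
      rcases pos_and_pos_or_neg_and_neg_of_mul_pos hbc.2 with h' | h' <;> nlinarith

theorem mul_neg_of_not_sameSign (X : LabeledGraph V W) (hk : ∀ v, X.k v ≠ 0) {w : W}
    (h : ¬ X.SameSign (X.ini w) (X.ter w)) : X.k (X.ini w) * X.k (X.ter w) < 0 := by
  refine lt_of_le_of_ne ?_ (mul_ne_zero (hk _) (hk _))
  by_contra! hlt
  exact h (Relation.ReflTransGen.single ⟨⟨w, rfl, rfl⟩, hlt⟩)

/-- With nonvanishing charges, a sign function of type (ii) is the sign of the charge. -/
theorem TypeII.mul_charge_pos {X : LabeledGraph V W} (hk : ∀ v, X.k v ≠ 0) {s : V → ℝ}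
    (hs : X.TypeII s) (v : V) : 0 < s v * X.k v := by
  obtain ⟨-, h2, h3, v₀, hs₀, hk₀⟩ := hs
  induction X.connected v₀ v with
  | refl => rw [hs₀]; linarith
  | tail _ hbc ih =>
    obtain ⟨w, rfl, rfl⟩ := hbc
    rw [ini_rev]
    by_cases hw : X.SameSign (X.ini w) (X.ter w)
    · have hkk := X.mul_pos_of_sameSign hk hw
      rw [← h2 _ _ hw]
      rcases pos_and_pos_or_neg_and_neg_of_mul_pos ih with h | h <;>
        rcases pos_and_pos_or_neg_and_neg_of_mul_pos hkk with h' | h' <;> nlinarith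
    · have hkk := X.mul_neg_of_not_sameSign hk hw
      rw [h3 w hw] at ih
      rcases pos_and_pos_or_neg_and_neg_of_mul_pos ih with h | h <;>
        rcases mul_neg_iff.mp hkk with h' | h' <;> nlinarith

theorem exists_typeII (X : LabeledGraph V W) (hk : ∀ v, X.k v ≠ 0) (hpos : ∃ v, 0 < X.k v) :
    ∃ s, X.TypeII s := by
  refine ⟨fun v => if 0 < X.k v then 1 else -1, fun v => ?_, fun u v h => ?_, fun w h => ?_, ?_⟩
  · dsimp only
    split_ifs <;> simp
  · rcases pos_and_pos_or_neg_and_neg_of_mul_pos (X.mul_pos_of_sameSign hk h) with h | h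
    · simp [h.1, h.2]
    · simp [h.1.not_gt, h.2.not_gt]
  · rcases mul_neg_iff.mp (X.mul_neg_of_not_sameSign hk h) with h | h
    · simp [h.1, h.2.not_gt]
    · simp [h.1.not_gt, h.2]
  · obtain ⟨v, hv⟩ := hpos
    exact ⟨v, by simp [hv], hv⟩

/-- A vertex of zero charge supports a solution with vanishing angle function. -/
theorem exists_solution_of_charge_eq_zero (X : LabeledGraph V W) {v : V} (hv : X.k v = 0) :
    ∃ (a : V → ℝ) (γ : W → ℝ), X.BKN a γ ∧ X.Compatible a γ ∧ X.SymSol γ := by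
  refine ⟨Pi.single v 1, 0, fun u => ?_, ⟨fun u => ?_, ?_, ?_, ?_, ?_⟩, fun w => rfl⟩
  · by_cases h : u = v
    · simp [h, hv]
    · simp [h]
  · by_cases h : u = v
    · simp [h]
    · simp [h]
  · simp
  · simp
  · simp
  · simp

/-- With nonvanishing charges, a nonzero vector at which the quadratic form of `H` is nonpositive
gives rise to a compatible symmetric solution. -/
theorem TypeII.exists_solution {X : LabeledGraph V W} (hk : ∀ v, X.k v ≠ 0) {s : V → ℝ}
    (hs : X.TypeII s) {x : V → ℝ} (hx : x ≠ 0) (h : x ⬝ᵥ X.Hop s *ᵥ x ≤ 0) :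
    ∃ (a : V → ℝ) (γ : W → ℝ), X.BKN a γ ∧ X.Compatible a γ ∧ X.SymSol γ := by
  classical
  rw [dotProduct_Hop_mulVec, sub_nonpos, ← dotProduct_weightedAdj_mulVec] at h
  obtain ⟨t, ht0, ht1, a, ha0, hane, heq⟩ :=
    exists_nonneg_generalized_eigenvector (hs.mul_charge_pos hk)
      (X.weightedAdj_isHermitian X.innerWeight_rev)
      (fun i j => Finset.sum_nonneg fun w _ => X.innerWeight_nonneg w) hx h
  obtain ⟨h1, h2, -, -⟩ := hs
  set γ : W → ℝ := fun w =>
    if X.SameSign (X.ini w) (X.ter w) ∧ a (X.ini w) ≠ 0 ∧ a (X.ter w) ≠ 0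
    then s (X.ini w) * t else 0 with hγ
  have hsym : X.SymSol γ := by
    intro w
    simp only [hγ, ini_rev, ter_rev]
    by_cases hw : X.SameSign (X.ini w) (X.ter w)
    · simp [hw, X.sameSign_symm hw, h2 _ _ hw, and_comm]
    · have hw' : ¬ X.SameSign (X.ter w) (X.ini w) := fun h => hw (X.sameSign_symm h)
      simp [hw, hw']
  have hvanish : ∀ v, a v = 0 → ∀ w, X.ini w = v → γ w = 0 := by
    rintro v hv w rfl
    simp [hγ, hv]
  refine ⟨a, γ, fun v => ?_, ⟨ha0, hane, fun w => ?_, fun w _ => hsym w, fun v hv w hw => ?_⟩,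
    hsym⟩
  · by_cases hv : a v = 0
    · rw [hv, mul_zero]
      refine (Finset.sum_eq_zero fun w hw => ?_).symm
      rw [hvanish v hv w (Finset.mem_filter.mp hw).2]
      simp
    · have hss : s v * s v = 1 := by
        rcases h1 v with h | h <;> rw [h] <;> norm_num
      have hv' := heq v
      rw [weightedAdj_mulVec] at hv'
      calc X.k v * a v = s v * (s v * X.k v * a v) := by
            linear_combination -(X.k v * a v) * hss
        _ = s v * t * ∑ w ∈ univ.filter (fun w => X.ini w = v),
              X.innerWeight w * a (X.ter w) := by rw [hv', mul_assoc]
        _ = _ := by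
          rw [Finset.mul_sum]
          refine Finset.sum_congr rfl fun w hw => ?_
          have hwv := (Finset.mem_filter.mp hw).2
          simp only [hγ, innerWeight, hwv]
          by_cases hw1 : X.SameSign v (X.ter w) <;> by_cases hw2 : a (X.ter w) = 0
          · simp [hw2]
          · simp only [hw1, hv, hw2, ne_eq, not_false_eq_true, and_self, if_true]
            ring
          · simp [hw2]
          · simp [hw1]
  · simp only [hγ]
    split_ifs
    · rw [abs_mul, abs_of_nonneg ht0]
      rcases h1 (X.ini w) with h | h <;> rw [h] <;> simpa using ht1
    · simp
  · rw [hsym w, and_self]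
    exact hvanish v hv w hw

end LabeledGraph

open LabeledGraph in
/-- Spectral criterion for (VE): the BKN-equation over `X` (with all charges zero or at
least one positive charge) has a compatible symmetric solution iff the operator `H`
associated with an admissible sign function `s` has a nonpositive real eigenvalue. -/
theorem compatible_symmetric_solution_iff_hop_nonpos_eigenvalue
    {V W : Type} [Fintype V] [DecidableEq V] [Fintype W] [DecidableEq W]
    (X : LabeledGraph V W)
    (hcharges : (∀ v, X.k v = 0) ∨ (∃ v, 0 < X.k v))
    (s : V → ℝ) (hs : X.Admissible s) :
    (∃ (a : V → ℝ) (γ : W → ℝ), X.BKN a γ ∧ X.Compatible a γ ∧ X.SymSol γ) ↔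
      HasNonposEigenvalue (X.Hop s) := by
  constructor
  · rintro ⟨a, γ, hbkn, ⟨ha, hane, hγ, -, -⟩, hsym⟩
    exact (X.Hop_isHermitian s).exists_nonpos_eigenvalue hane
      (X.dotProduct_Hop_mulVec_nonpos hs hbkn ha hγ hsym)
  · rintro ⟨μ, hμ, x, hx, hxμ⟩
    by_cases hk : ∃ v, X.k v = 0
    · obtain ⟨v, hv⟩ := hk
      exact X.exists_solution_of_charge_eq_zero hv
    · push Not at hk
      have hpos : ∃ v, 0 < X.k v := by
        refine hcharges.resolve_left fun h0 => ?_
        obtain ⟨w⟩ := X.edges_nonempty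
        exact hk _ (h0 (X.ini w))
      have hII : X.TypeII s := hs.resolve_right fun h => h.2 (X.exists_typeII hk hpos)
      refine hII.exists_solution hk hx ?_
      rw [hxμ, dotProduct_smul, smul_eq_mul]
      exact mul_nonpos_of_nonpos_of_nonneg hμ
        (Finset.sum_nonneg fun v _ => mul_self_nonneg (x v))
end
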